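/- For all integers p ≥ 0, r_j(r_j(e^{(p)})) = (v − v⁻¹)(v² − v⁻²) v^{2(p−3)} Σ_{a=0}^{p−2} (−1)^a v^{−3a} Ĕ_j^{(a)} Ĕ_i^{(p)} Ĕ_j^{(p−2−a)}, with the convention that the sum is zero when p ≤ 1. -/

import Mathlib

noncomputable section

/-- The field ℚ(v) of rational functions over ℚ. -/
abbrev Qv : Type := RatFunc ℚ

/-- The indeterminate v. -/
def vv : Qv := RatFunc.X

/-- The quantum integer [a] = (v^a - v^{-a})/(v - v⁻¹). -/
def qint (a : ℕ) : Qv := (vv ^ (a : ℤ) - vv ^ (-(a : ℤ))) / (vv - vv⁻¹)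

/-- The quantum factorial [a]! = [a][a-1]⋯[1]. -/
def qfact : ℕ → Qv
  | 0 => 1
  | n + 1 => qint (n + 1) * qfact n

/-- Divided power x^{(p)} = x^p / [p]!. -/
def dp {A : Type} [Ring A] [Algebra Qv A] (x : A) (p : ℕ) : A :=
  (qfact p)⁻¹ • x ^ p

/-- The affine type A Cartan matrix entries c_{ij} = 2δ_{i,j} - δ_{i,j+1} - δ_{i,j-1}. -/
def cartan {m : ℕ} (i j : ZMod m) : ℤ :=
  (if i = j then 2 else 0) - (if i = j + 1 then 1 else 0) - (if i = j - 1 then 1 else 0)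

/-- Generators of the quantum affine algebra U(ŝl_m). -/
inductive Gen (m : ℕ) : Type
  | E : ZMod m → Gen m
  | F : ZMod m → Gen m
  | K : ZMod m → Gen m
  | Kinv : ZMod m → Gen m

abbrev FA (m : ℕ) := FreeAlgebra Qv (Gen m)

def fE {m : ℕ} (i : ZMod m) : FA m := FreeAlgebra.ι Qv (Gen.E i)
def fF {m : ℕ} (i : ZMod m) : FA m := FreeAlgebra.ι Qv (Gen.F i)
def fK {m : ℕ} (i : ZMod m) : FA m := FreeAlgebra.ι Qv (Gen.K i)
def fKinv {m : ℕ} (i : ZMod m) : FA m := FreeAlgebra.ι Qv (Gen.Kinv i)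

/-- The defining relations of the quantum affine algebra U(ŝl_m). -/
inductive URel (m : ℕ) : FA m → FA m → Prop
  | KK : ∀ i j, URel m (fK i * fK j) (fK j * fK i)
  | KKinv : ∀ i, URel m (fK i * fKinv i) 1
  | KinvK : ∀ i, URel m (fKinv i * fK i) 1
  | KE : ∀ i j, URel m (fK i * fE j) (vv ^ cartan i j • (fE j * fK i))
  | KF : ∀ i j, URel m (fK i * fF j) (vv ^ (-cartan i j) • (fF j * fK i))
  | EF : ∀ i j, URel m (fE i * fF j - fF j * fE i)
      (if i = j then (vv - vv⁻¹)⁻¹ • (fK i - fKinv i) else 0)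
  | serreE : ∀ i j, i ≠ j →
      URel m (∑ p ∈ Finset.range ((1 - cartan i j).toNat + 1),
        ((-1 : Qv) ^ p) • (dp (fE i) p * fE j * dp (fE i) ((1 - cartan i j).toNat - p))) 0
  | serreF : ∀ i j, i ≠ j →
      URel m (∑ p ∈ Finset.range ((1 - cartan i j).toNat + 1),
        ((-1 : Qv) ^ p) • (dp (fF i) p * fF j * dp (fF i) ((1 - cartan i j).toNat - p))) 0

/-- The quantum affine algebra U(ŝl_m), presented by generators and relations. -/
abbrev U (m : ℕ) := RingQuot (URel m)

def UE {m : ℕ} (i : ZMod m) : U m := RingQuot.mkAlgHom Qv (URel m) (fE i)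
def UF {m : ℕ} (i : ZMod m) : U m := RingQuot.mkAlgHom Qv (URel m) (fF i)
def UK {m : ℕ} (i : ZMod m) : U m := RingQuot.mkAlgHom Qv (URel m) (fK i)
def UKinv {m : ℕ} (i : ZMod m) : U m := RingQuot.mkAlgHom Qv (URel m) (fKinv i)

/-- The element e_r = Ĕ_r Ĕ_{r+1} − v^ε Ĕ_{r+1} Ĕ_r in U(ŝl_{n+1}). -/
def er (n r : ℕ) (ε : ℤ) : U (n + 1) :=
  UE (r : ZMod (n + 1)) * UE ((r : ZMod (n + 1)) + 1) -
    vv ^ ε • (UE ((r : ZMod (n + 1)) + 1) * UE (r : ZMod (n + 1)))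

/-- The element f_r = F̆_{r+1} F̆_r − v^{−ε} F̆_r F̆_{r+1} in U(ŝl_{n+1}). -/
def fr (n r : ℕ) (ε : ℤ) : U (n + 1) :=
  UF ((r : ZMod (n + 1)) + 1) * UF (r : ZMod (n + 1)) -
    vv ^ (-ε) • (UF (r : ZMod (n + 1)) * UF ((r : ZMod (n + 1)) + 1))

/-- The element k_r = K̆_r K̆_{r+1} in U(ŝl_{n+1}). -/
def kr (n r : ℕ) : U (n + 1) :=
  UK (r : ZMod (n + 1)) * UK ((r : ZMod (n + 1)) + 1)

/-- The image e_i ∈ U(ŝl_{n+1}) of the generator E_i, i ∈ ℤ/nℤ. -/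
def eElt (n r : ℕ) (ε : ℤ) (i : ZMod n) : U (n + 1) :=
  if i.val < r then UE ((i.val : ZMod (n + 1)))
  else if i.val = r then er n r ε
  else UE ((i.val + 1 : ℕ) : ZMod (n + 1))

def fElt (n r : ℕ) (ε : ℤ) (i : ZMod n) : U (n + 1) :=
  if i.val < r then UF ((i.val : ZMod (n + 1)))
  else if i.val = r then fr n r ε
  else UF ((i.val + 1 : ℕ) : ZMod (n + 1))

def kElt (n r : ℕ) (i : ZMod n) : U (n + 1) :=
  if i.val < r then UK ((i.val : ZMod (n + 1)))
  else if i.val = r then kr n r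
  else UK ((i.val + 1 : ℕ) : ZMod (n + 1))

def kinvElt (n r : ℕ) (i : ZMod n) : U (n + 1) :=
  if i.val < r then UKinv ((i.val : ZMod (n + 1)))
  else if i.val = r then UKinv (r : ZMod (n + 1)) * UKinv ((r : ZMod (n + 1)) + 1)
  else UKinv ((i.val + 1 : ℕ) : ZMod (n + 1))


/-- The positive half U⁺: the subalgebra of U(ŝl_3) generated by the Ĕ_k. -/
def Uplus : Subalgebra Qv (U 3) := Algebra.adjoin Qv (Set.range (UE (m := 3)))

/-- The generator Ĕ_k, viewed as an element of U⁺. -/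
def Egen (k : ZMod 3) : Uplus := ⟨UE k, Algebra.subset_adjoin ⟨k, rfl⟩⟩

/-- The submodule of U⁺ of homogeneous elements of multidegree d ∈ ℕ^{ℤ/3ℤ}. -/
def homog (d : ZMod 3 → ℕ) : Submodule Qv Uplus :=
  Submodule.span Qv
    {x | ∃ w : List (ZMod 3), (∀ c, w.count c = d c) ∧ x = (w.map Egen).prod}

/-- k·|y| = 2y_k − y_{k+1} − y_{k−1} for a multidegree |y| = d. -/
def kdot (k : ZMod 3) (d : ZMod 3 → ℕ) : ℤ :=
  2 * (d k : ℤ) - (d (k + 1) : ℤ) - (d (k - 1) : ℤ)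

/-- The family rr of ℚ(v)-linear maps r_k : U⁺ → U⁺ is the family of Lusztig's twisted
derivations: r_k(1) = 0, r_k(Ĕ_{k'}) = δ_{k,k'}, and
r_k(xy) = v^{k·|y|} r_k(x) y + x r_k(y) for homogeneous x, y. -/
def IsTwistedDerivation (rr : ZMod 3 → (Uplus →ₗ[Qv] Uplus)) : Prop :=
  (∀ k, rr k 1 = 0) ∧
  (∀ k k', rr k (Egen k') = if k = k' then 1 else 0) ∧
  (∀ k (dx dy : ZMod 3 → ℕ) (x y : Uplus), x ∈ homog dx → y ∈ homog dy →
    rr k (x * y) = vv ^ kdot k dy • (rr k x * y) + x * rr k y)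

/-- The element e = Ĕ_i Ĕ_j − v⁻¹ Ĕ_j Ĕ_i ∈ U⁺, with j = i + 1. -/
def ee (i : ZMod 3) : Uplus :=
  Egen i * Egen (i + 1) - vv⁻¹ • (Egen (i + 1) * Egen i)

lemma vv_ne_zero : vv ≠ 0 := RatFunc.X_ne_zero

lemma vv_pow_ne_one {n : ℕ} (hn : n ≠ 0) : vv ^ n ≠ 1 := by
  intro h
  have h' : algebraMap (Polynomial ℚ) Qv (Polynomial.X ^ n) =
      algebraMap (Polynomial ℚ) Qv 1 := by
    rw [map_pow, RatFunc.algebraMap_X, map_one]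
    exact h
  have := congrArg Polynomial.natDegree (RatFunc.algebraMap_injective ℚ h')
  simp [hn] at this

lemma vv_sub_inv_ne_zero : vv - vv⁻¹ ≠ 0 := by
  intro h
  apply vv_pow_ne_one two_ne_zero
  have := vv_ne_zero
  field_simp at h
  linear_combination h

lemma qint_succ_ne_zero (n : ℕ) : qint (n + 1) ≠ 0 := by
  refine div_ne_zero (fun h => vv_pow_ne_one (n := 2 * (n + 1)) (by omega) ?_) vv_sub_inv_ne_zero
  have h0 := pow_ne_zero (n + 1) vv_ne_zero
  rw [zpow_neg, zpow_natCast, sub_eq_zero] at h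
  rw [two_mul, pow_add]
  nth_rw 1 [h]
  exact inv_mul_cancel₀ h0

lemma qint_zero : qint 0 = 0 := by simp [qint]

lemma qint_one : qint 1 = 1 := by
  simp [qint, div_self vv_sub_inv_ne_zero]

lemma qint_two : qint 2 = vv + vv⁻¹ := by
  rw [qint, div_eq_iff vv_sub_inv_ne_zero]
  simp only [zpow_neg, zpow_natCast]
  have := vv_ne_zero
  field_simp
  ring

lemma qint_add (a b : ℕ) :
    qint (a + b) = vv ^ (-(a : ℤ)) * qint b + vv ^ (b : ℤ) * qint a := by
  have h := vv_sub_inv_ne_zero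
  simp only [qint]
  rw [mul_div_assoc', mul_div_assoc', ← add_div]
  congr 1
  have ha := pow_ne_zero a vv_ne_zero
  have hb := pow_ne_zero b vv_ne_zero
  simp only [zpow_neg, zpow_natCast, pow_add]
  field_simp
  ring

section DividedPowers

variable {A : Type} [Ring A] [Algebra Qv A]

lemma dp_zero (x : A) : dp x 0 = 1 := by simp [dp, qfact]

lemma dp_one (x : A) : dp x 1 = x := by simp [dp, qfact, qint_one]

lemma qint_smul_dp_succ (x : A) (n : ℕ) : qint (n + 1) • dp x (n + 1) = dp x n * x := by
  simp only [dp, qfact]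
  rw [smul_smul, mul_inv, mul_inv_cancel_left₀ (qint_succ_ne_zero n), pow_succ, smul_mul_assoc]

lemma qint_smul_dp_succ' (x : A) (n : ℕ) : qint (n + 1) • dp x (n + 1) = x * dp x n := by
  rw [qint_smul_dp_succ, dp, smul_mul_assoc, mul_smul_comm, ← pow_succ, ← pow_succ']

lemma qint_smul_dp_two (x : A) : qint 2 • dp x 2 = x * x := by
  rw [qint_smul_dp_succ, dp_one]

lemma map_dp {B : Type} [Ring B] [Algebra Qv B] (f : A →ₐ[Qv] B) (x : A) (n : ℕ) :
    f (dp x n) = dp (f x) n := by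
  simp [dp]

/-- If `y` and `x` commute up to the scalar `c`, then so do `y` and the divided powers of `x`. -/
lemma dp_mul_of_qcomm {x y : A} {c : Qv} (h : x * y = c • (y * x)) (n : ℕ) :
    dp x n * y = c ^ n • (y * dp x n) := by
  have key : x ^ n * y = c ^ n • (y * x ^ n) := by
    induction n with
    | zero => simp
    | succ n ih =>
      rw [pow_succ', mul_assoc, ih, mul_smul_comm, ← mul_assoc, h, smul_mul_assoc, smul_smul,
        mul_assoc, ← pow_succ]
  rw [dp, smul_mul_assoc, key, mul_smul_comm, smul_comm]

/-- By the Serre relation, `x` commutes with the `v`-commutator of `x` and `y` up to `v`. -/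
lemma mul_qcommutator_of_serre {x y e : A} (he : x * y = e + vv⁻¹ • (y * x))
    (h : y * (x * x) + x * x * y = (vv + vv⁻¹) • (x * y * x)) : x * e = vv • (e * x) := by
  have hv : vv * vv⁻¹ = 1 := mul_inv_cancel₀ vv_ne_zero
  rw [← sub_eq_iff_eq_add] at he
  subst he
  simp only [mul_sub, sub_mul, mul_smul_comm, smul_mul_assoc, smul_sub, smul_smul, hv, one_smul,
    add_smul, mul_assoc] at h ⊢
  rw [← sub_eq_zero] at h ⊢
  rw [← h]
  abel

/-- By the Serre relation, the `v`-commutator of `x` and `y` commutes with `y` up to `v`. -/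
lemma qcommutator_mul_of_serre {x y e : A} (he : x * y = e + vv⁻¹ • (y * x))
    (h : x * (y * y) + y * y * x = (vv + vv⁻¹) • (y * x * y)) : e * y = vv • (y * e) := by
  have hv : vv * vv⁻¹ = 1 := mul_inv_cancel₀ vv_ne_zero
  rw [← sub_eq_iff_eq_add] at he
  subst he
  simp only [mul_sub, sub_mul, mul_smul_comm, smul_mul_assoc, smul_sub, smul_smul, hv, one_smul,
    add_smul, mul_assoc] at h ⊢
  rw [← sub_eq_zero] at h ⊢
  rw [← h]
  abel

lemma smul_add_self (c : Qv) (z : A) : c • z + z = (c + 1) • z := by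
  rw [add_smul, one_smul]

lemma dp_succ_mul_eq {x y e : A} (he : x * y = e + vv⁻¹ • (y * x)) (hx : x * e = vv • (e * x))
    (m : ℕ) :
    dp x (m + 1) * y =
      vv ^ (-((m : ℤ) + 1)) • (y * dp x (m + 1)) + vv ^ (-(m : ℤ)) • (dp x m * e) := by
  have hv := vv_ne_zero
  induction m with
  | zero => simp [dp_zero, dp_one, he, add_comm]
  | succ m ih =>
    have hq := qint_succ_ne_zero (m + 1)
    have hxe : e * x = vv⁻¹ • (x * e) := by rw [hx, smul_smul, inv_mul_cancel₀ hv, one_smul]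
    have hexp : dp x m * e * x = (vv⁻¹ * qint (m + 1)) • (dp x (m + 1) * e) := by
      rw [mul_assoc, hxe, mul_smul_comm, ← mul_assoc, ← qint_smul_dp_succ, smul_mul_assoc,
        smul_smul]
    have hqint : qint (m + 1 + 1) = vv⁻¹ * qint (m + 1) + vv ^ ((m : ℤ) + 1) := by
      rw [add_comm (m + 1) 1, qint_add 1 (m + 1), qint_one, Nat.cast_one, zpow_neg_one, mul_one,
        Nat.cast_add, Nat.cast_one]
    have hzpow : vv ^ (-((m : ℤ) + 1)) * vv ^ ((m : ℤ) + 1) = 1 := by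
      rw [← zpow_add₀ hv, neg_add_cancel, zpow_zero]
    have hzpow' : vv⁻¹ * vv ^ (-(m : ℤ)) = vv ^ (-((m : ℤ) + 1)) := by
      rw [← zpow_neg_one, ← zpow_add₀ hv, neg_add_rev]
    have hzpow'' : vv⁻¹ * vv ^ (-((m : ℤ) + 1)) = vv ^ (-((m : ℤ) + 1 + 1)) := by
      rw [← zpow_neg_one, ← zpow_add₀ hv, neg_add_rev (_ + 1)]
    refine smul_right_injective A hq ?_
    simp only [smul_add]
    rw [← smul_mul_assoc, qint_smul_dp_succ, mul_assoc, he, mul_add, mul_smul_comm, ← mul_assoc, ih,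
      add_mul, smul_mul_assoc, smul_mul_assoc, hexp, mul_assoc, ← qint_smul_dp_succ]
    simp only [mul_smul_comm, smul_smul, smul_add, Nat.cast_add, Nat.cast_one, ← hzpow'']
    rw [add_comm, add_assoc, smul_add_self]
    congr 2
    · ring
    · linear_combination (vv⁻¹ * qint (m + 1)) * hzpow' - vv ^ (-((m : ℤ) + 1)) * hqint - hzpow

/-- The expansion of `x^{(m)} e^{(n)}`, where `e` is the `v`-commutator of `x` and `y`. -/
lemma dp_mul_dp_qcommutator {x y e : A} (he : x * y = e + vv⁻¹ • (y * x))
    (hx : x * e = vv • (e * x)) (hy : e * y = vv • (y * e)) (n m : ℕ) :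
    dp x m * dp e n = ∑ a ∈ Finset.range (n + 1),
      ((-1) ^ a * vv ^ ((m : ℤ) * n - (m + 1) * a)) • (dp y a * dp x (n + m) * dp y (n - a)) := by
  have hv := vv_ne_zero
  induction n generalizing m with
  | zero => simp [dp_zero]
  | succ n ih =>
    have hstep : dp x m * e = vv ^ (m : ℤ) • (dp x (m + 1) * y) - vv⁻¹ • (y * dp x (m + 1)) := by
      rw [dp_succ_mul_eq he hx, smul_add, smul_smul, smul_smul, ← zpow_add₀ hv, ← zpow_add₀ hv,
        add_neg_cancel, zpow_zero, one_smul, neg_add, add_neg_cancel_left, zpow_neg_one,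
        add_sub_cancel_left]
    have hcomm : y * dp e n = vv ^ (-(n : ℤ)) • (dp e n * y) := by
      rw [dp_mul_of_qcomm hy, smul_smul, zpow_neg, zpow_natCast,
        inv_mul_cancel₀ (pow_ne_zero n hv), one_smul]
    have hright (a : ℕ) (ha : a ∈ Finset.range (n + 1)) :
        dp y a * dp x (n + (m + 1)) * dp y (n - a) * y =
          qint (n + 1 - a) • (dp y a * dp x (n + 1 + m) * dp y (n + 1 - a)) := by
      have ha' : n + 1 - a = n - a + 1 := by
        have := Finset.mem_range.mp ha
        omega
      rw [mul_assoc, ← qint_smul_dp_succ, mul_smul_comm, ha', add_assoc n 1 m, add_comm 1 m]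
    have hleft (a : ℕ) :
        y * (dp y a * dp x (n + (m + 1)) * dp y (n - a)) =
          qint (a + 1) • (dp y (a + 1) * dp x (n + 1 + m) * dp y (n + 1 - (a + 1))) := by
      rw [← mul_assoc, ← mul_assoc, ← qint_smul_dp_succ', smul_mul_assoc, smul_mul_assoc,
        Nat.add_sub_add_right, add_assoc n 1 m, add_comm 1 m]
    refine smul_right_injective A (qint_succ_ne_zero n) ?_
    simp only
    rw [← mul_smul_comm, qint_smul_dp_succ', ← mul_assoc, hstep, sub_mul, smul_mul_assoc,
      smul_mul_assoc, mul_assoc, hcomm, mul_smul_comm, ← mul_assoc, mul_assoc y, ih, Finset.sum_mul,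
      Finset.mul_sum]
    simp only [smul_mul_assoc, mul_smul_comm, hleft]
    rw [Finset.sum_congr rfl fun a ha => by rw [hright a ha]]
    simp only [Finset.smul_sum, smul_smul]
    set t : ℕ → A := fun a => dp y a * dp x (n + 1 + m) * dp y (n + 1 - a)
    have hfirst (c : ℕ → Qv) : ∑ a ∈ Finset.range (n + 1), (c a * qint (n + 1 - a)) • t a =
        ∑ a ∈ Finset.range (n + 1 + 1), (c a * qint (n + 1 - a)) • t a := by
      rw [Finset.sum_range_succ _ (n + 1), Nat.sub_self, qint_zero, mul_zero, zero_smul, add_zero]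
    have hsecond (c : ℕ → Qv) : ∑ a ∈ Finset.range (n + 1), (c (a + 1) * qint (a + 1)) • t (a + 1) =
        ∑ a ∈ Finset.range (n + 1 + 1), (c a * qint a) • t a := by
      rw [Finset.sum_range_succ' _ (n + 1), qint_zero, mul_zero, zero_smul, add_zero]
    have hcoeff₁ (a : ℕ) : vv ^ (m : ℤ) * (vv ^ (-(n : ℤ)) *
        ((-1) ^ a * vv ^ (((m + 1 : ℕ) : ℤ) * n - ((m + 1 : ℕ) + 1) * a) * qint (n + 1 - a))) =
          ((-1) ^ a * vv ^ ((m : ℤ) * (n + 1) - (m + 2) * a)) * qint (n + 1 - a) := by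
      have : (m : ℤ) * (n + 1) - (m + 2) * a =
          m + -n + (((m + 1 : ℕ) : ℤ) * n - ((m + 1 : ℕ) + 1) * a) := by
        push_cast
        ring
      rw [this, zpow_add₀ hv, zpow_add₀ hv]
      ring
    have hcoeff₂ (a : ℕ) : vv⁻¹ *
        ((-1) ^ a * vv ^ (((m + 1 : ℕ) : ℤ) * n - ((m + 1 : ℕ) + 1) * a) * qint (a + 1)) =
          -((-1) ^ (a + 1) * vv ^ ((m + 1 : ℤ) * (n + 1) - (m + 2) * (a + 1 : ℕ))) *
            qint (a + 1) := by
      have : (m + 1 : ℤ) * (n + 1) - (m + 2) * (a + 1 : ℕ) =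
          -1 + (((m + 1 : ℕ) : ℤ) * n - ((m + 1 : ℕ) + 1) * a) := by
        push_cast
        ring
      rw [this, zpow_add₀ hv, zpow_neg_one]
      ring
    simp only [hcoeff₁, hcoeff₂]
    rw [hfirst fun a => (-1) ^ a * vv ^ ((m : ℤ) * (n + 1) - (m + 2) * a),
      hsecond fun a => -((-1) ^ a * vv ^ ((m + 1 : ℤ) * (n + 1) - (m + 2) * a)),
      ← Finset.sum_sub_distrib]
    refine Finset.sum_congr rfl fun a ha => ?_
    rw [← sub_smul]
    congr 1
    obtain ⟨b, hb⟩ := Nat.exists_eq_add_of_le (Nat.lt_succ_iff.mp (Finset.mem_range.mp ha))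
    have hbZ : (n : ℤ) + 1 = a + b := by exact_mod_cast hb
    have hexp₁ : (m : ℤ) * (n + 1) - (m + 2) * a =
        m * ((n + 1 : ℕ) : ℤ) - (m + 1) * a + -a := by
      push_cast
      ring
    have hexp₂ : (m + 1 : ℤ) * (n + 1) - (m + 2) * a =
        m * ((n + 1 : ℕ) : ℤ) - (m + 1) * a + b := by
      push_cast
      linear_combination hbZ
    rw [hexp₁, hexp₂, zpow_add₀ hv, zpow_add₀ hv, hb, qint_add, Nat.add_sub_cancel_left]
    ring

/-- The Serre relation without divided powers. -/
lemma serre_of_dp {x y : A} (h : y * dp x 2 + (-1 : Qv) • (x * y * x) + dp x 2 * y = 0) :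
    y * (x * x) + x * x * y = (vv + vv⁻¹) • (x * y * x) := by
  rw [← qint_two, ← qint_smul_dp_two, mul_smul_comm, smul_mul_assoc, ← smul_add]
  congr 1
  rw [neg_one_smul] at h
  rw [← sub_eq_zero, ← h]
  abel

section Derivation

variable {x y e : A} {D : A →ₗ[Qv] A}

lemma apply_dp_qcommutator (hxe : x * e = vv • (e * x)) (he : D e = (1 - vv ^ (-2 : ℤ)) • x)
    (hD : ∀ n : ℕ, D (e * dp e n) = vv ^ n • (D e * dp e n) + e * D (dp e n)) (n : ℕ) :
    D (dp e (n + 1)) = (1 - vv ^ (-2 : ℤ)) • (x * dp e n) := by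
  have hv := vv_ne_zero
  induction n with
  | zero => rw [zero_add, dp_one, dp_zero, mul_one, he]
  | succ n ih =>
    have hex : e * x = vv⁻¹ • (x * e) := by
      rw [hxe, smul_smul, inv_mul_cancel₀ hv, one_smul]
    refine smul_right_injective _ (qint_succ_ne_zero (n + 1)) ?_
    simp only
    rw [← map_smul, qint_smul_dp_succ', hD, ih, he, mul_smul_comm, ← mul_assoc, hex,
      smul_mul_assoc, smul_mul_assoc, mul_assoc, ← qint_smul_dp_succ', mul_smul_comm,
      add_comm (n + 1) 1, qint_add 1 (n + 1), qint_one]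
    simp only [smul_smul, ← add_smul]
    congr 1
    rw [Nat.cast_one, zpow_neg_one, zpow_natCast]
    ring

lemma apply_apply_dp_qcommutator (hxe : x * e = vv • (e * x)) (hx : D x = 0)
    (he : D e = (1 - vv ^ (-2 : ℤ)) • x)
    (hD : ∀ n : ℕ, D (e * dp e n) = vv ^ n • (D e * dp e n) + e * D (dp e n))
    (hDx : ∀ n : ℕ, D (x * dp e n) = vv ^ n • (D x * dp e n) + x * D (dp e n)) (n : ℕ) :
    D (D (dp e (n + 2))) = (1 - vv ^ (-2 : ℤ)) ^ 2 • (x * x * dp e n) := by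
  rw [apply_dp_qcommutator hxe he hD, map_smul, hDx, hx, apply_dp_qcommutator hxe he hD, zero_mul,
    smul_zero, zero_add, mul_smul_comm, smul_smul, sq, mul_assoc]

lemma apply_qcommutator (he : x * y = e + vv⁻¹ • (y * x)) (hxy : D (x * y) = x)
    (hyx : D (y * x) = vv⁻¹ • x) : D e = (1 - vv ^ (-2 : ℤ)) • x := by
  rw [← sub_eq_iff_eq_add] at he
  rw [← he, map_sub, map_smul, hxy, hyx, smul_smul, sub_smul, one_smul, ← mul_inv, ← sq]
  rfl

/-- The second derivative of the divided powers of the `v`-commutator `e` of `x` and `y`. -/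
theorem apply_apply_dp_eq_sum (he : x * y = e + vv⁻¹ • (y * x))
    (hyxx : y * (x * x) + x * x * y = (vv + vv⁻¹) • (x * y * x))
    (hxyy : x * (y * y) + y * y * x = (vv + vv⁻¹) • (y * x * y))
    (h1 : D 1 = 0) (hx : D x = 0) (hxy : D (x * y) = x) (hyx : D (y * x) = vv⁻¹ • x)
    (hD : ∀ n : ℕ, D (e * dp e n) = vv ^ n • (D e * dp e n) + e * D (dp e n))
    (hDx : ∀ n : ℕ, D (x * dp e n) = vv ^ n • (D x * dp e n) + x * D (dp e n)) (p : ℕ) :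
    D (D (dp e p)) =
      ((vv - vv⁻¹) * (vv ^ (2 : ℤ) - vv ^ (-2 : ℤ)) * vv ^ (2 * ((p : ℤ) - 3))) •
        ∑ a ∈ Finset.range (p - 1),
          ((-1 : Qv) ^ a * vv ^ (-(3 * (a : ℤ)))) •
            (dp y a * dp x p * dp y (p - 2 - a)) := by
  have hxe := mul_qcommutator_of_serre he hyxx
  have hey := qcommutator_mul_of_serre he hxyy
  have hDe := apply_qcommutator he hxy hyx
  rcases p with _ | _ | n
  · simp [dp_zero, h1]
  · simp [dp_one, hDe, hx]
  rw [apply_apply_dp_qcommutator hxe hx hDe hD hDx, ← qint_smul_dp_two, smul_mul_assoc,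
    dp_mul_dp_qcommutator he hxe hey, qint_two]
  simp only [Finset.smul_sum, smul_smul]
  refine Finset.sum_congr rfl fun a _ => ?_
  congr 1
  have hv := vv_ne_zero
  have hexp : vv ^ (((2 : ℕ) : ℤ) * n - ((2 : ℕ) + 1) * a) =
      vv ^ 2 * vv ^ (2 * (((n + 1 + 1 : ℕ) : ℤ) - 3)) * vv ^ (-(3 * (a : ℤ))) := by
    rw [← zpow_natCast vv 2, ← zpow_add₀ hv, ← zpow_add₀ hv]
    congr 1
    push_cast
    ring
  have hvv : (1 - vv ^ (-2 : ℤ)) ^ 2 * (vv + vv⁻¹) * vv ^ 2 =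
      (vv - vv⁻¹) * (vv ^ (2 : ℤ) - vv ^ (-2 : ℤ)) := by
    field_simp
    ring
  rw [hexp, ← hvv]
  ring

end Derivation

end DividedPowers

lemma cartan_self_add_one (i : ZMod 3) : cartan i (i + 1) = -1 := by
  revert i; decide

lemma cartan_add_one_self (i : ZMod 3) : cartan (i + 1) i = -1 := by
  revert i; decide

lemma Egen_serre {k l : ZMod 3} (hkl : k ≠ l) (hc : cartan k l = -1) :
    Egen l * (Egen k * Egen k) + Egen k * Egen k * Egen l =
      (vv + vv⁻¹) • (Egen k * Egen l * Egen k) := by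
  have h := RingQuot.mkAlgHom_rel Qv (URel.serreE k l hkl)
  rw [hc] at h
  have h2 : (1 - (-1) : ℤ).toNat = 2 := rfl
  simp only [h2, Finset.sum_range_succ, Finset.sum_range_zero, map_add, map_smul, map_mul, map_dp,
    map_zero, zero_add, dp_zero, dp_one, pow_zero, pow_one, one_smul, one_mul, mul_one,
    Nat.sub_self, Nat.sub_zero, Nat.add_one_sub_one, even_two, Even.neg_pow, one_pow] at h
  exact Subtype.ext (serre_of_dp h)

lemma Egen_mem_homog (k : ZMod 3) : Egen k ∈ homog (Pi.single k 1) :=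
  Submodule.subset_span ⟨[k], fun c => by
    rcases eq_or_ne c k with rfl | h <;> simp [*, Ne.symm], by simp⟩

lemma one_mem_homog : (1 : Uplus) ∈ homog 0 :=
  Submodule.subset_span ⟨[], by simp, by simp⟩

lemma mul_mem_homog {d d' : ZMod 3 → ℕ} {x y : Uplus} (hx : x ∈ homog d) (hy : y ∈ homog d') :
    x * y ∈ homog (d + d') := by
  have h := Submodule.mul_mem_mul hx hy
  rw [homog, homog, Submodule.span_mul_span] at h
  refine Submodule.span_mono ?_ h
  rintro _ ⟨_, ⟨w, hw, rfl⟩, _, ⟨w', hw', rfl⟩, rfl⟩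
  exact ⟨w ++ w', by simp [hw, hw'], by simp⟩

lemma pow_mem_homog {d : ZMod 3 → ℕ} {x : Uplus} (hx : x ∈ homog d) (n : ℕ) :
    x ^ n ∈ homog (n • d) := by
  induction n with
  | zero => simpa using one_mem_homog
  | succ n ih => rw [pow_succ, succ_nsmul]; exact mul_mem_homog ih hx

lemma ee_mem_homog (i : ZMod 3) : ee i ∈ homog (Pi.single i 1 + Pi.single (i + 1) 1) := by
  have h := mul_mem_homog (Egen_mem_homog (i + 1)) (Egen_mem_homog i)
  rw [add_comm] at h
  have h' := mul_mem_homog (Egen_mem_homog i) (Egen_mem_homog (i + 1))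
  unfold ee
  exact Submodule.sub_mem (M := Uplus) _ h' ((homog _).smul_mem vv⁻¹ h)

lemma dp_ee_mem_homog (i : ZMod 3) (n : ℕ) :
    dp (ee i) n ∈ homog (n • (Pi.single i 1 + Pi.single (i + 1) 1)) :=
  Submodule.smul_mem _ _ (pow_mem_homog (ee_mem_homog i) n)

lemma kdot_nsmul (k : ZMod 3) (n : ℕ) (d : ZMod 3 → ℕ) : kdot k (n • d) = n * kdot k d := by
  simp only [kdot, Pi.smul_apply, smul_eq_mul, Nat.cast_mul]
  ring

lemma kdot_ee (i : ZMod 3) : kdot (i + 1) (Pi.single i 1 + Pi.single (i + 1) 1) = 1 := by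
  revert i; decide

lemma kdot_add_one_single (i : ZMod 3) : kdot (i + 1) (Pi.single i 1) = -1 := by
  revert i; decide

lemma Egen_mul_Egen_add_one (i : ZMod 3) :
    Egen i * Egen (i + 1) = ee i + vv⁻¹ • (Egen (i + 1) * Egen i) := by
  unfold ee
  exact (sub_add_cancel (Egen i * Egen (i + 1)) _).symm

/-- for all p ≥ 0,
r_j(r_j(e^{(p)})) = (v − v⁻¹)(v² − v⁻²) v^{2(p−3)}
  Σ_{a=0}^{p−2} (−1)^a v^{−3a} Ĕ_j^{(a)} Ĕ_i^{(p)} Ĕ_j^{(p−2−a)}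
(the sum being zero when p ≤ 1). -/
theorem twisted_derivation_rj_rj
    (rr : ZMod 3 → (Uplus →ₗ[Qv] Uplus)) (hrr : IsTwistedDerivation rr)
    (i : ZMod 3) (p : ℕ) :
    rr (i + 1) (rr (i + 1) (dp (ee i) p)) =
      ((vv - vv⁻¹) * (vv ^ (2 : ℤ) - vv ^ (-2 : ℤ)) * vv ^ (2 * ((p : ℤ) - 3))) •
        ∑ a ∈ Finset.range (p - 1),
          ((-1 : Qv) ^ a * vv ^ (-(3 * (a : ℤ)))) •
            (dp (Egen (i + 1)) a * dp (Egen i) p * dp (Egen (i + 1)) (p - 2 - a)) := by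
  obtain ⟨h1, hE, hD⟩ := hrr
  have hx : rr (i + 1) (Egen i) = 0 := by rw [hE, if_neg (by simp)]
  have hDdp (n : ℕ) {d : ZMod 3 → ℕ} {z : Uplus} (hz : z ∈ homog d) :
      rr (i + 1) (z * dp (ee i) n) =
        vv ^ n • (rr (i + 1) z * dp (ee i) n) + z * rr (i + 1) (dp (ee i) n) := by
    rw [hD _ _ _ _ _ hz (dp_ee_mem_homog i n), kdot_nsmul, kdot_ee, mul_one, zpow_natCast]
  refine apply_apply_dp_eq_sum (A := Uplus) (x := Egen i) (y := Egen (i + 1)) (e := ee i)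
    (D := rr (i + 1)) (Egen_mul_Egen_add_one i)
    (Egen_serre (by simp) (cartan_self_add_one i)) (Egen_serre (by simp) (cartan_add_one_self i))
    (h1 _) hx ?_ ?_ (fun n => hDdp n (ee_mem_homog i)) (fun n => hDdp n (Egen_mem_homog i)) p
  · rw [hD _ _ _ _ _ (Egen_mem_homog i) (Egen_mem_homog (i + 1)), hx, hE, if_pos rfl, zero_mul,
      smul_zero, zero_add, mul_one]
  · rw [hD _ _ _ _ _ (Egen_mem_homog (i + 1)) (Egen_mem_homog i), hx, hE, if_pos rfl,
      kdot_add_one_single, mul_zero, add_zero, one_mul, zpow_neg_one]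

end
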